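/- Fix n, l, r with 0 ≤ l ≤ n-2 < r ≤ 2n-3, l + r < 2n-2 and r - l > n-3. Then Σ_{1 ≤ e_1 < ... < e_{n-1} ≤ r+1} det_{1≤i,j≤n-1}( t·C(j-1, e_i - j) − t·C(j-1, r - e_i - l + 2n - 1 - j) + C(j-1, e_i - 1 - j) − C(j-1, r - e_i - l + 2n - j) ) is the generating function (in t) for (n-1)-tuples of non-intersecting north/east lattice paths with starting points S_j = (j, -2j) for j = 1,...,n-1, endpoints among E_m = (m, -m) for m = 1,...,r+1, with the path starting at S_{n-1} staying weakly above the line y = x + l - r - 2n + 1, where each path ending with a north step contributes a factor t. -/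

import Mathlib

/-- Binomial coefficient `C(a, b)` with integer lower index, `0` for `b < 0`
(and `0` for `b > a`, as usual). -/
def intChoose (a : ℕ) (b : ℤ) : ℤ := if 0 ≤ b then (a.choose b.toNat : ℤ) else 0

/-- The index set `{1 ≤ e_1 < e_2 < … < e_m ≤ r + 1}` as strictly increasing
`m`-tuples. -/
def incTuples (m r : ℕ) : Finset (Fin m → ℕ) :=
  (Fintype.piFinset fun _ => Finset.Icc 1 (r + 1)).filter
    fun e => ∀ i j : Fin m, i < j → e i < e j

/-- The `(n-1) × (n-1)` determinant (a polynomial in `t = X`)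
`det( t·C(j-1, e_i - j) − t·C(j-1, r - e_i - l + 2n - 1 - j)
      + C(j-1, e_i - 1 - j) − C(j-1, r - e_i - l + 2n - j) )`,
where rows and columns are indexed by `i, j ∈ {1,…,n-1}` (here `0`-based, so the
paper's `j` is `(j : ℕ) + 1` and the paper's `j - 1` is `(j : ℕ)`). -/
noncomputable def astDet (n l r : ℕ) (e : Fin (n - 1) → ℕ) : Polynomial ℤ :=
  Matrix.det fun i j : Fin (n - 1) =>
    Polynomial.C (intChoose (j : ℕ) ((e i : ℤ) - ((j : ℕ) + 1))
        - intChoose (j : ℕ) ((r : ℤ) - (e i : ℤ) - (l : ℤ) + 2 * (n : ℤ) - 1 - ((j : ℕ) + 1)))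
      * Polynomial.X
    + Polynomial.C (intChoose (j : ℕ) ((e i : ℤ) - 1 - ((j : ℕ) + 1))
        - intChoose (j : ℕ) ((r : ℤ) - (e i : ℤ) - (l : ℤ) + 2 * (n : ℤ) - ((j : ℕ) + 1)))

/-- A (nonempty) lattice path, recorded as its list of visited points: consecutive points
differ by a unit east step `(1,0)` or a unit north step `(0,1)`. -/
def IsLatticePath (L : List (ℤ × ℤ)) : Prop :=
  L ≠ [] ∧ L.Chain' fun p q => q = (p.1 + 1, p.2) ∨ q = (p.1, p.2 + 1)

/-- The path ends with a north step. -/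
def EndsNorth (L : List (ℤ × ℤ)) : Prop :=
  ∃ (L' : List (ℤ × ℤ)) (p : ℤ × ℤ), L = L' ++ [p, (p.1, p.2 + 1)]

namespace AstPaths

/-- East increments of all particles. -/
def shift {N : ℕ} (x : Fin N → ℕ) (d : Fin N → Fin 2) : Fin N → ℕ := fun j => x j + (d j : ℕ)

/-- Weight of a north step with `u` steps remaining afterwards. -/
noncomputable def northWt (u : ℕ) : Polynomial ℤ := if u = 0 then Polynomial.X else 1

/-- One-step transition weight from time `u + 1` (remaining) to time `u`. Particles at
positions `x ≤ u` have not started yet and are frozen. -/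
noncomputable def stepWt (R u x : ℕ) (d : Fin 2) : Polynomial ℤ :=
  if u + 1 ≤ x then
    (if u + 1 + 2 * x + 1 ≤ R then (if d = 0 then northWt u else 1) else 0)
  else (if d = 0 then 1 else 0)

/-- Weighted number of single-particle continuations. -/
noncomputable def ker (R : ℕ) : ℕ → ℕ → ℕ → Polynomial ℤ
  | 0, x, e => if x = e then 1 else 0
  | u + 1, x, e => ∑ d : Fin 2, stepWt R u x d * ker R u (x + (d : ℕ)) e

/-- Sum of determinants. -/
noncomputable def detSum (N r R u : ℕ) (x : Fin N → ℕ) : Polynomial ℤ :=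
  ∑ e ∈ incTuples N r, Matrix.det (Matrix.of fun j i : Fin N => ker R u (x j) (e i))

theorem mem_incTuples {m r : ℕ} {e : Fin m → ℕ} :
    e ∈ incTuples m r ↔ (∀ j, 1 ≤ e j ∧ e j ≤ r + 1) ∧ StrictMono e := by
  unfold incTuples StrictMono
  simp [Fintype.mem_piFinset]

theorem detSum_zero {N r R : ℕ} {x : Fin N → ℕ} (hx : StrictMono x) :
    detSum N r R 0 x = if x ∈ incTuples N r then 1 else 0 := by
  unfold detSum
  have key : ∀ e ∈ incTuples N r,
      Matrix.det (Matrix.of fun j i : Fin N => ker R 0 (x j) (e i)) = if x = e then 1 else 0 := by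
    intro e he
    rw [mem_incTuples] at he
    split_ifs with h
    · subst h
      have : (Matrix.of fun j i : Fin N => ker R 0 (x j) (x i)) = 1 := by
        ext1 j i
        simp [ker, Matrix.one_apply, hx.injective.eq_iff]
      rw [this, Matrix.det_one]
    · by_contra hdet
      have hcol : ∀ i, ∃ j, x j = e i := by
        intro i
        by_contra hc
        push Not at hc
        exact hdet (Matrix.det_eq_zero_of_column_eq_zero i (fun j => by simp [ker, hc j]))
      choose f hf using hcol
      have hinj : Function.Injective f := by
        intro a b hab
        apply he.2.injective
        rw [← hf a, ← hf b, hab]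
      have hsurj := Finite.surjective_of_injective hinj
      apply h
      apply (StrictMono.range_inj hx he.2).1
      ext y
      constructor
      · rintro ⟨j, rfl⟩
        obtain ⟨i, rfl⟩ := hsurj j
        exact ⟨i, (hf i).symm⟩
      · rintro ⟨i, rfl⟩
        exact ⟨f i, hf i⟩
  rw [Finset.sum_congr rfl key, Finset.sum_ite_eq]

theorem detSum_succ_all (N r R u : ℕ) (x : Fin N → ℕ) :
    detSum N r R (u + 1) x
      = ∑ d : Fin N → Fin 2, (∏ j, stepWt R u (x j) (d j)) * detSum N r R u (shift x d) := by
  unfold detSum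
  simp_rw [Finset.mul_sum]
  rw [Finset.sum_comm]
  refine Finset.sum_congr rfl fun e _ => ?_
  have h1 : (Matrix.of fun j i : Fin N => ker R (u + 1) (x j) (e i))
      = fun j => ∑ d : Fin 2, (stepWt R u (x j) d • fun i => ker R u (x j + (d : ℕ)) (e i)) := by
    ext1 j i
    simp [ker]
  have h2 := (Matrix.detRowAlternating (n := Fin N) (R := Polynomial ℤ)).toMultilinearMap.map_sum
    (α := fun _ => Fin 2)
    (fun j d => (stepWt R u (x j) d • fun i => ker R u (x j + (d : ℕ)) (e i)))
  rw [h1]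
  refine h2.trans ?_
  refine Finset.sum_congr rfl fun d _ => ?_
  exact MultilinearMap.map_smul_univ _ (fun j => stepWt R u (x j) (d j))
    (fun j i => ker R u (x j + (d j : ℕ)) (e i))

theorem detSum_eq_zero {N r R u : ℕ} {x : Fin N → ℕ} (hx : ¬ Function.Injective x) :
    detSum N r R u x = 0 := by
  unfold Function.Injective at hx
  push Not at hx
  obtain ⟨a, b, hab, hne⟩ := hx
  refine Finset.sum_eq_zero fun e _ => ?_
  exact Matrix.det_zero_of_row_eq hne (by ext1 i; simp [hab])

theorem shift_not_inj {N : ℕ} {x : Fin N → ℕ} (hx : StrictMono x) {d : Fin N → Fin 2}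
    (h : ¬ StrictMono (shift x d)) : ¬ Function.Injective (shift x d) := by
  intro hinj
  apply h
  intro i j hij
  have h1 := hx hij
  have h2 : shift x d i ≠ shift x d j := fun h => hij.ne (hinj h)
  unfold shift at *
  have := (d i).2
  omega

open Classical in
/-- The allowed moves. -/
noncomputable def moves {N : ℕ} (R u : ℕ) (x : Fin N → ℕ) : Finset (Fin N → Fin 2) :=
  Finset.univ.filter fun d => StrictMono (shift x d) ∧ (∀ j, x j ≤ u → d j = 0) ∧
    ∀ j, u + 1 ≤ x j → u + 1 + 2 * x j + 1 ≤ R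

theorem detSum_succ {N r R u : ℕ} {x : Fin N → ℕ} (hx : StrictMono x) :
    detSum N r R (u + 1) x
      = ∑ d ∈ moves R u x, (∏ j, stepWt R u (x j) (d j)) * detSum N r R u (shift x d) := by
  rw [detSum_succ_all]
  symm
  refine Finset.sum_subset (Finset.subset_univ _) fun d _ hd => ?_
  simp only [moves, Finset.mem_filter, Finset.mem_univ, true_and] at hd
  by_cases h1 : StrictMono (shift x d)
  · by_cases h2 : ∀ j, x j ≤ u → d j = 0
    · by_cases h3 : ∀ j, u + 1 ≤ x j → u + 1 + 2 * x j + 1 ≤ R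
      · exact absurd ⟨h1, h2, h3⟩ hd
      · push Not at h3
        obtain ⟨j, hj1, hj2⟩ := h3
        rw [Finset.prod_eq_zero (Finset.mem_univ j), zero_mul]
        unfold stepWt
        rw [if_pos hj1, if_neg (by omega)]
    · push Not at h2
      obtain ⟨j, hj1, hj2⟩ := h2
      rw [Finset.prod_eq_zero (Finset.mem_univ j), zero_mul]
      unfold stepWt
      rw [if_neg (by omega), if_neg hj2]
  · rw [detSum_eq_zero (shift_not_inj hx h1), mul_zero]

/-! ### Closed form of the kernel (reflection principle) -/

theorem intChoose_succ (a : ℕ) (b : ℤ) :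
    intChoose (a + 1) b = intChoose a b + intChoose a (b - 1) := by
  unfold intChoose
  rcases lt_trichotomy b 0 with h | h | h
  · rw [if_neg (by omega), if_neg (by omega), if_neg (by omega)]; rfl
  · subst h; simp
  · obtain ⟨k, rfl⟩ : ∃ k : ℕ, b = (k : ℤ) + 1 := ⟨(b - 1).toNat, by omega⟩
    rw [if_pos (by omega), if_pos (by omega), if_pos (by omega)]
    have e1 : ((k : ℤ) + 1).toNat = k + 1 := by omega
    have e2 : ((k : ℤ) + 1 - 1).toNat = k := by omega
    rw [e1, e2, Nat.choose_succ_succ]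
    push_cast; ring

theorem intChoose_symm {a : ℕ} {b c : ℤ} (h : b + c = a) : intChoose a b = intChoose a c := by
  unfold intChoose
  by_cases hb : 0 ≤ b
  · by_cases hc : 0 ≤ c
    · rw [if_pos hb, if_pos hc, Nat.choose_symm_of_eq_add (n := a) (a := b.toNat) (b := c.toNat)]
      omega
    · rw [if_pos hb, if_neg hc, Nat.choose_eq_zero_of_lt (by omega)]; rfl
  · by_cases hc : 0 ≤ c
    · rw [if_neg hb, if_pos hc, Nat.choose_eq_zero_of_lt (by omega)]; rfl
    · rw [if_neg hb, if_neg hc]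

theorem intChoose_zero (b : ℤ) : intChoose 0 b = if b = 0 then 1 else 0 := by
  unfold intChoose
  split_ifs with h1 h2 h2
  · subst h2; simp
  · rw [Nat.choose_eq_zero_of_lt (by omega)]; rfl
  · omega
  · rfl

/-- The closed form. -/
noncomputable def closed (R u x e : ℕ) : Polynomial ℤ :=
  Polynomial.C (intChoose u ((e : ℤ) - x) - intChoose u ((R : ℤ) - e - 1 - x)) * Polynomial.X
  + Polynomial.C (intChoose u ((e : ℤ) - 1 - x) - intChoose u ((R : ℤ) - e - x))

theorem ker_closed {R e : ℕ} (he : 2 * e + 1 ≤ R) :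
    ∀ u x : ℕ, u + 1 ≤ x → u + 1 + 2 * x ≤ R → ker R (u + 1) x e = closed R u x e := by
  intro u
  induction u with
  | zero =>
    intro x hx hR
    by_cases hl : 0 + 1 + 2 * x + 1 ≤ R
    · simp only [ker, stepWt, if_pos hx, if_pos hl, Fin.sum_univ_two, closed, intChoose_zero]
      rw [if_neg (show ¬ ((R : ℤ) - e - 1 - x = 0) by omega),
        if_neg (show ¬ ((R : ℤ) - e - x = 0) by omega)]
      by_cases h1 : x = e
      · subst h1; simp [northWt]
      · by_cases h2 : x + 1 = e
        · subst h2; simp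
        · have h3 : ¬ ((e : ℤ) - x = 0) := by omega
          have h4 : ¬ ((e : ℤ) - 1 - x = 0) := by omega
          simp [h1, h2, h3, h4]
    · simp only [ker, stepWt, if_pos hx, if_neg hl, closed]
      rw [intChoose_symm (show ((e : ℤ) - x) + ((R : ℤ) - e - 1 - x) = ((0 : ℕ) : ℤ) by omega),
        intChoose_symm (show ((e : ℤ) - 1 - x) + ((R : ℤ) - e - x) = ((0 : ℕ) : ℤ) by omega)]
      simp
  | succ u ih =>
    intro x hx hR
    by_cases hl : u + 1 + 1 + 2 * x + 1 ≤ R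
    · rw [ker]
      simp only [stepWt, if_pos hx, if_pos hl, Fin.sum_univ_two]
      have e0 : x + ((0 : Fin 2) : ℕ) = x := rfl
      have e1 : x + ((1 : Fin 2) : ℕ) = x + 1 := rfl
      rw [e0, e1, ih x (by omega) (by omega), ih (x + 1) (by omega) (by omega)]
      simp only [closed, intChoose_succ u]
      push_cast
      have r1 : (e : ℤ) - (x + 1) = e - x - 1 := by ring
      have r2 : (R : ℤ) - e - 1 - (x + 1) = R - e - 1 - x - 1 := by ring
      have r3 : (e : ℤ) - 1 - (x + 1) = e - 1 - x - 1 := by ring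
      have r4 : (R : ℤ) - e - (x + 1) = R - e - x - 1 := by ring
      rw [r1, r2, r3, r4]
      simp [northWt]
      ring
    · simp only [ker, stepWt, if_pos hx, if_neg hl, closed]
      rw [intChoose_symm (show ((e : ℤ) - x) + ((R : ℤ) - e - 1 - x) = ((u + 1 : ℕ) : ℤ) by
          push_cast; omega),
        intChoose_symm (show ((e : ℤ) - 1 - x) + ((R : ℤ) - e - x) = ((u + 1 : ℕ) : ℤ) by
          push_cast; omega)]
      simp

theorem ker_frozen (R x e : ℕ) : ∀ k, ker R (x + k) x e = ker R x x e := by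
  intro k
  induction k with
  | zero => rfl
  | succ k ih =>
    rw [← ih, ← Nat.add_assoc, ker]
    simp [stepWt, show ¬ (x + k + 1 ≤ x) by omega]

theorem ker_start {R N x e : ℕ} (he : 2 * e + 1 ≤ R) (hx : x + 1 ≤ N) (hR : 3 * N ≤ R) :
    ker R N (x + 1) e = closed R x (x + 1) e := by
  obtain ⟨k, rfl⟩ := Nat.exists_eq_add_of_le hx
  rw [ker_frozen, ker_closed he _ _ le_rfl (by omega)]

theorem astDet_sum {n l r : ℕ} (hl : l + 2 ≤ n)
    (hlr : l + r + 2 < 2 * n) (hwide : l + n < r + 3) :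
    ∑ e ∈ incTuples (n - 1) r, astDet n l r e
      = detSum (n - 1) r (r + 2 * n - l) (n - 1) (fun j => (j : ℕ) + 1) := by
  refine Finset.sum_congr rfl fun e he => ?_
  rw [mem_incTuples] at he
  unfold astDet
  rw [← Matrix.det_transpose]
  congr 1
  ext1 i j
  have h := he.1 i
  have hj := j.2
  simp only [Matrix.transpose_apply, Matrix.of_apply]
  rw [ker_start (by omega) (by omega) (by omega)]
  unfold closed
  have hc : ((r + 2 * n - l : ℕ) : ℤ) = (r : ℤ) + 2 * n - l := by omega
  rw [hc]
  push_cast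
  congr 2 <;> congr 3 <;> ring_nf

/-! ### Lattice paths -/

/-- Position of the first recorded point of a particle at position `x` at time `u`. -/
def hd (u x : ℕ) : ℤ × ℤ := ((x : ℤ), if u ≤ x then -(u : ℤ) - x else -2 * (x : ℤ))

theorem isLatticePath_cons_cons {a b : ℤ × ℤ} {L : List (ℤ × ℤ)} :
    IsLatticePath (a :: b :: L) ↔
      (b = (a.1 + 1, a.2) ∨ b = (a.1, a.2 + 1)) ∧ IsLatticePath (b :: L) := by
  unfold IsLatticePath
  constructor
  · rintro ⟨_, h⟩
    have := List.isChain_cons_cons.1 h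
    exact ⟨this.1, by simp, this.2⟩
  · rintro ⟨h1, _, h2⟩
    exact ⟨by simp, List.isChain_cons_cons.2 ⟨h1, h2⟩⟩

theorem isLatticePath_singleton (a : ℤ × ℤ) : IsLatticePath [a] :=
  ⟨by simp, List.isChain_singleton a⟩

theorem lattice_sum_le {L : List (ℤ × ℤ)} : ∀ {a : ℤ × ℤ}, IsLatticePath (a :: L) →
    ∀ q ∈ L, a.1 + a.2 < q.1 + q.2 := by
  induction L with
  | nil => intro a _ q hq; simp at hq
  | cons b L ih =>
    intro a h q hq
    obtain ⟨h1, h2⟩ := isLatticePath_cons_cons.1 h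
    have hab : a.1 + a.2 + 1 = b.1 + b.2 := by
      rcases h1 with rfl | rfl <;> simp <;> ring
    rcases List.mem_cons.1 hq with rfl | hq
    · omega
    · have := ih h2 q hq
      omega

theorem lattice_head_le {L : List (ℤ × ℤ)} {a : ℤ × ℤ} (h : IsLatticePath L)
    (ha : L.head? = some a) : ∀ q ∈ L, a.1 + a.2 ≤ q.1 + q.2 := by
  cases L with
  | nil => simp at ha
  | cons b L =>
    simp at ha
    subst ha
    intro q hq
    rcases List.mem_cons.1 hq with rfl | hq
    · exact le_rfl
    · exact (lattice_sum_le h q hq).le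

/-- The path tuples at time `u`, with particles at positions `x`. -/
def Good (N r R u : ℕ) (x : Fin N → ℕ) (P : Fin N → List (ℤ × ℤ)) : Prop :=
  (∀ j, IsLatticePath (P j)) ∧
  (∀ j, (P j).head? = some (hd u (x j))) ∧
  (∀ j, ∃ m : ℕ, 1 ≤ m ∧ m ≤ r + 1 ∧ (P j).getLast? = some ((m : ℤ), -(m : ℤ))) ∧
  (∀ j k, j ≠ k → ∀ q ∈ P j, q ∉ P k) ∧
  (∀ j : Fin N, (j : ℕ) + 1 = N → ∀ q ∈ P j, q.1 + 1 - (R : ℤ) ≤ q.2)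

/-- Prepend the current point to all paths that have started. -/
def consAt {N : ℕ} (u : ℕ) (x : Fin N → ℕ) (P : Fin N → List (ℤ × ℤ)) :
    Fin N → List (ℤ × ℤ) :=
  fun j => if u + 1 ≤ x j then hd (u + 1) (x j) :: P j else P j

theorem single_fwd {u x : ℕ} {L : List (ℤ × ℤ)} {m : ℕ} (hL : IsLatticePath L)
    (hh : L.head? = some (hd (u + 1) x)) (hm : L.getLast? = some ((m : ℤ), -(m : ℤ))) :
    ∃ d : Fin 2, ∃ L' : List (ℤ × ℤ), (x ≤ u → d = 0) ∧
      L = (if u + 1 ≤ x then hd (u + 1) x :: L' else L') ∧ IsLatticePath L' ∧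
      L'.head? = some (hd u (x + (d : ℕ))) ∧ L'.getLast? = L.getLast? := by
  by_cases hx : u + 1 ≤ x
  · match L, hh with
    | [a], hh =>
      simp [hd, hx] at hh hm
      subst hh
      simp at hm
      omega
    | a :: b :: L', hh =>
      simp only [List.head?_cons, Option.some.injEq] at hh
      obtain ⟨h1, h2⟩ := isLatticePath_cons_cons.1 hL
      rcases h1 with h1 | h1
      · refine ⟨1, b :: L', by omega, by rw [if_pos hx, hh], h2, ?_, by simp⟩
        rw [List.head?_cons, h1, hh]
        simp only [hd, if_pos hx, if_pos (show u ≤ x + ((1 : Fin 2) : ℕ) by omega)]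
        simp
        ring
      · refine ⟨0, b :: L', by omega, by rw [if_pos hx, hh], h2, ?_, by simp⟩
        rw [List.head?_cons, h1, hh]
        simp only [hd, if_pos hx, if_pos (show u ≤ x + ((0 : Fin 2) : ℕ) by omega)]
        simp
        ring
  · refine ⟨0, L, fun _ => rfl, by rw [if_neg hx], hL, ?_, rfl⟩
    rw [hh]
    simp only [hd, if_neg hx]
    simp
    intro h
    have : x = u := by omega
    omega

theorem le_of_strictMono {N : ℕ} {x : Fin N → ℕ} (hx : StrictMono x) (h1 : ∀ j, 1 ≤ x j) :
    ∀ (k : ℕ) (hk : k < N), k + 1 ≤ x ⟨k, hk⟩ := by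
  intro k
  induction k with
  | zero => intro hk; exact h1 _
  | succ k ih =>
    intro hk
    have := ih (by omega)
    have h2 : x ⟨k, by omega⟩ < x ⟨k + 1, hk⟩ := hx (by simp [Fin.lt_def])
    omega

theorem hd_sum_active {u x : ℕ} (h : u ≤ x) : (hd u x).1 + (hd u x).2 = -(u : ℤ) := by
  simp only [hd, if_pos h]; ring

theorem hd_sum_frozen {u x : ℕ} (h : x ≤ u) : (hd u x).1 + (hd u x).2 = -(x : ℤ) := by
  unfold hd
  split_ifs with h1
  · have : x = u := by omega
    subst this
    simp
  · simp; ring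

theorem good_succ {N r R u : ℕ} {x : Fin N → ℕ} (hx : StrictMono x) (h1 : ∀ j, 1 ≤ x j)
    (hu : u + 1 ≤ N) (P : Fin N → List (ℤ × ℤ)) :
    Good N r R (u + 1) x P ↔
      ∃ d ∈ moves R u x, ∃ P', Good N r R u (shift x d) P' ∧ consAt u x P' = P := by
  have hlast := le_of_strictMono hx h1 (N - 1) (by omega)
  have hle : ∀ j, x j ≤ x ⟨N - 1, by omega⟩ := fun j =>
    hx.monotone (by rw [Fin.le_def]; have := j.2; simp; omega)
  constructor
  · rintro ⟨hlat, hhead, hend, hdis, hline⟩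
    have hs := fun j => single_fwd (hlat j) (hhead j) (hend j).choose_spec.2.2
    choose d P' hd0 hP hlat' hhead' hend' using hs
    have hsub : ∀ j, ∀ q ∈ P' j, q ∈ P j := by
      intro j q hq
      rw [hP j]
      split_ifs
      · exact List.mem_cons_of_mem _ hq
      · exact hq
    refine ⟨d, ?_, P', ⟨hlat', hhead', ?_, ?_, ?_⟩, ?_⟩
    · simp only [moves, Finset.mem_filter, Finset.mem_univ, true_and]
      refine ⟨?_, hd0, ?_⟩
      · by_contra hns
        have := shift_not_inj hx hns
        unfold Function.Injective at this
        push Not at this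
        obtain ⟨a, b, hab, hne⟩ := this
        unfold shift at hab
        have ha := List.mem_of_mem_head? (hhead' a)
        have hb := List.mem_of_mem_head? (hhead' b)
        rw [hab] at ha
        exact hdis a b hne _ (hsub a _ ha) (hsub b _ hb)
      · intro j hj
        have h2 := hline ⟨N - 1, by omega⟩ (by simp; omega) _
          (List.mem_of_mem_head? (hhead _))
        have h3 := hle j
        simp only [hd] at h2
        rw [if_pos (by omega)] at h2
        push_cast at h2
        omega
    · intro j
      obtain ⟨m, hm⟩ := hend j
      exact ⟨m, by rw [hend' j]; exact hm⟩
    · intro j k hjk q hq hq'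
      exact hdis j k hjk q (hsub j q hq) (hsub k q hq')
    · intro j hj q hq
      exact hline j hj q (hsub j q hq)
    · funext j
      exact (hP j).symm
  · rintro ⟨d, hdm, P', ⟨hlat, hhead, hend, hdis, hline⟩, rfl⟩
    simp only [moves, Finset.mem_filter, Finset.mem_univ, true_and] at hdm
    obtain ⟨hmono, hd0, hcond⟩ := hdm
    have hlate : ∀ j, ∀ q ∈ P' j, -(u : ℤ) ≤ q.1 + q.2 := by
      intro j q hq
      have := lattice_head_le (hlat j) (hhead j) q hq
      rcases le_total u (shift x d j) with h | h
      · rw [hd_sum_active h] at this; exact this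
      · rw [hd_sum_frozen h] at this; omega
    have hmem : ∀ j q, q ∈ consAt u x P' j ↔
        (u + 1 ≤ x j ∧ q = hd (u + 1) (x j)) ∨ q ∈ P' j := by
      intro j q
      unfold consAt
      split_ifs with h <;> simp [h]
    have hne : ∀ j, P' j ≠ [] := fun j => (hlat j).1
    refine ⟨?_, ?_, ?_, ?_, ?_⟩
    · intro j
      unfold consAt
      split_ifs with h
      · have hh := hhead j
        have hl := hlat j
        match hPj : P' j, hh, hl with
        | b :: L, hh, hl =>
          rw [isLatticePath_cons_cons]
          refine ⟨?_, hl⟩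
          simp only [List.head?_cons, Option.some.injEq] at hh
          rw [hh]
          unfold shift hd
          rw [if_pos h, if_pos (by omega)]
          have : d j = 0 ∨ d j = 1 := by omega
          rcases this with h0 | h0
          · right; rw [h0]; simp; ring
          · left; rw [h0]; simp; ring
      · exact hlat j
    · intro j
      unfold consAt
      split_ifs with h
      · rfl
      · rw [hhead j]
        unfold shift
        rw [hd0 j (by omega)]
        simp only [hd, if_neg h]
        simp
        intro h'
        have : x j = u := by omega
        omega
    · intro j
      obtain ⟨m, hm1, hm2, hm⟩ := hend j
      refine ⟨m, hm1, hm2, ?_⟩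
      unfold consAt
      split_ifs with h
      · rw [← hm]
        match P' j, hne j with
        | b :: L, _ => simp
      · exact hm
    · intro j k hjk q hq hq'
      rw [hmem] at hq hq'
      rcases hq with ⟨ha, hq⟩ | hq
      · have hs := hd_sum_active ha
        rw [← hq] at hs
        rcases hq' with ⟨hb, hq'⟩ | hq'
        · rw [hq] at hq'
          have := congrArg Prod.fst hq'
          simp [hd] at this
          exact hjk (hx.injective this)
        · have := hlate k q hq'
          push_cast at hs
          omega
      · rcases hq' with ⟨hb, hq'⟩ | hq'
        · have hs := hd_sum_active hb
          rw [← hq'] at hs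
          have := hlate j q hq
          push_cast at hs
          omega
        · exact hdis j k hjk q hq hq'
    · intro j hj q hq
      rw [hmem] at hq
      rcases hq with ⟨ha, hq⟩ | hq
      · have := hcond j ha
        rw [hq]
        simp only [hd, if_pos ha]
        push_cast
        omega
      · exact hline j hj q hq

theorem good_zero {N r R : ℕ} {x : Fin N → ℕ} (hx : StrictMono x)
    (hR : 2 * r + 3 ≤ R) (P : Fin N → List (ℤ × ℤ)) :
    Good N r R 0 x P ↔ x ∈ incTuples N r ∧ P = fun j => [hd 0 (x j)] := by
  rw [mem_incTuples]
  constructor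
  · rintro ⟨hlat, hhead, hend, hdis, hline⟩
    have key : ∀ j, (1 ≤ x j ∧ x j ≤ r + 1) ∧ P j = [hd 0 (x j)] := by
      intro j
      obtain ⟨m, hm1, hm2, hm⟩ := hend j
      have hh := hhead j
      have hl := hlat j
      match hPj : P j, hh, hl, hm with
      | [a], hh, hl, hm =>
        simp at hh hm
        subst hh
        simp [hd] at hm
        refine ⟨by omega, rfl⟩
      | a :: b :: L, hh, hl, hm =>
        exfalso
        have h2 := lattice_sum_le hl ((m : ℤ), -(m : ℤ))
          (by
            rw [List.getLast?_cons_cons] at hm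
            exact List.mem_of_mem_getLast? hm)
        simp at hh
        rw [hh, hd_sum_active (Nat.zero_le _)] at h2
        simp at h2
    exact ⟨⟨fun j => (key j).1, hx⟩, funext fun j => (key j).2⟩
  · rintro ⟨⟨hb, _⟩, rfl⟩
    refine ⟨fun j => isLatticePath_singleton _, fun j => rfl, fun j => ⟨x j, (hb j).1, (hb j).2, ?_⟩,
      ?_, ?_⟩
    · simp [hd]
    · intro j k hjk q hq hq'
      simp at hq hq'
      rw [hq] at hq'
      have := congrArg Prod.fst hq'
      simp [hd] at this
      exact hjk (hx.injective this)
    · intro j _ q hq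
      simp at hq
      have := hb j
      rw [hq]
      simp [hd]
      omega

/-- The finite set of path tuples. -/
noncomputable def paths (N r R : ℕ) : ℕ → (Fin N → ℕ) → Finset (Fin N → List (ℤ × ℤ))
  | 0, x => if x ∈ incTuples N r then {fun j => [hd 0 (x j)]} else ∅
  | u + 1, x => (moves R u x).biUnion fun d => (paths N r R u (shift x d)).image (consAt u x)

theorem shift_pos {N : ℕ} {x : Fin N → ℕ} (h1 : ∀ j, 1 ≤ x j) (d : Fin N → Fin 2) :
    ∀ j, 1 ≤ shift x d j := fun j => le_trans (h1 j) (Nat.le_add_right _ _)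

theorem moves_strictMono {N R u : ℕ} {x : Fin N → ℕ} {d : Fin N → Fin 2}
    (h : d ∈ moves R u x) : StrictMono (shift x d) := by
  simp only [moves, Finset.mem_filter] at h
  exact h.2.1

theorem mem_paths {N r R : ℕ} (hR : 2 * r + 3 ≤ R) (u : ℕ) :
    ∀ (x : Fin N → ℕ), StrictMono x → (∀ j, 1 ≤ x j) → u ≤ N → ∀ P,
      (P ∈ paths N r R u x ↔ Good N r R u x P) := by
  induction u with
  | zero =>
    intro x hx h1 hu P
    rw [good_zero hx hR, paths]
    split_ifs with h <;> simp [h]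
  | succ u ih =>
    intro x hx h1 hu P
    rw [good_succ hx h1 hu, paths]
    simp only [Finset.mem_biUnion, Finset.mem_image]
    refine exists_congr fun d => and_congr_right fun hd => exists_congr fun P' => ?_
    rw [ih _ (moves_strictMono hd) (shift_pos h1 d) (by omega)]

open Classical in
/-- Weight of a single path. -/
noncomputable def endWt (L : List (ℤ × ℤ)) : Polynomial ℤ :=
  if EndsNorth L then Polynomial.X else 1

theorem endsNorth_singleton (a : ℤ × ℤ) : ¬ EndsNorth [a] := by
  rintro ⟨L', p, h⟩
  have := congrArg List.length h
  simp at this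

theorem endsNorth_pair (a b : ℤ × ℤ) : EndsNorth [a, b] ↔ b = (a.1, a.2 + 1) := by
  constructor
  · rintro ⟨L', p, h⟩
    have h2 := congrArg List.length h
    simp at h2
    subst h2
    simp at h
    rw [h.2, h.1]
  · rintro rfl
    exact ⟨[], a, rfl⟩

theorem endsNorth_cons (a b c : ℤ × ℤ) (L : List (ℤ × ℤ)) :
    EndsNorth (a :: b :: c :: L) ↔ EndsNorth (b :: c :: L) := by
  constructor
  · rintro ⟨L', p, h⟩
    match L', h with
    | [], h => simp at h
    | a' :: L', h =>
      refine ⟨L', p, ?_⟩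
      simp at h
      exact h.2
  · rintro ⟨L', p, h⟩
    exact ⟨a :: L', p, by rw [h]; rfl⟩

theorem endWt_cons (a b c : ℤ × ℤ) (L : List (ℤ × ℤ)) :
    endWt (a :: b :: c :: L) = endWt (b :: c :: L) := by
  have h := endsNorth_cons a b c L
  unfold endWt
  by_cases h1 : EndsNorth (b :: c :: L)
  · rw [if_pos h1, if_pos (h.2 h1)]
  · rw [if_neg h1, if_neg (fun h2 => h1 (h.1 h2))]

theorem endWt_step {N r R u : ℕ} {x : Fin N → ℕ} (h1 : ∀ j, 1 ≤ x j)
    {d : Fin N → Fin 2} (hd' : d ∈ moves R u x) {P : Fin N → List (ℤ × ℤ)}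
    (hP : Good N r R u (shift x d) P) (j : Fin N) :
    endWt (consAt u x P j) = stepWt R u (x j) (d j) * endWt (P j) := by
  simp only [moves, Finset.mem_filter, Finset.mem_univ, true_and] at hd'
  obtain ⟨hmono, hd0, hcond⟩ := hd'
  obtain ⟨hlat, hhead, hend, -, -⟩ := hP
  unfold consAt stepWt
  by_cases hx : u + 1 ≤ x j
  · rw [if_pos hx, if_pos hx, if_pos (hcond j hx)]
    have hact : u ≤ shift x d j := le_trans (by omega) (Nat.le_add_right (x j) _)
    obtain ⟨m, -, -, hm⟩ := hend j
    have hh := hhead j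
    have hl := hlat j
    match hPj : P j, hh, hl, hm with
    | [b], hh, hl, hm =>
      simp at hh hm
      have hu : u = 0 := by
        have := hd_sum_active hact
        rw [← hh, hm] at this
        simp at this
        exact this
      subst hu
      unfold endWt
      rw [if_neg (endsNorth_singleton b), mul_one]
      simp only [endsNorth_pair, northWt, if_true]
      have : d j = 0 ∨ d j = 1 := by omega
      rw [hh]
      rcases this with h0 | h0
      · rw [if_pos h0, if_pos]
        simp only [hd, shift, h0, if_pos hx]
        simp
        ring
      · rw [if_neg (c := d j = 0) (by rw [h0]; decide), if_neg]
        intro hc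
        have := congrArg Prod.fst hc
        simp [hd, shift, h0] at this
    | b :: c :: L, hh, hl, hm =>
      have hu : u ≠ 0 := by
        rintro rfl
        have h2 := lattice_sum_le hl ((m : ℤ), -(m : ℤ))
          (by
            rw [List.getLast?_cons_cons] at hm
            exact List.mem_of_mem_getLast? hm)
        simp at hh
        rw [hh, hd_sum_active (Nat.zero_le _)] at h2
        simp at h2
      rw [endWt_cons, northWt, if_neg hu]
      simp
  · rw [if_neg hx, if_neg hx, if_pos (hd0 j (by omega)), one_mul]

theorem sum_paths {N r R : ℕ} (hR : 2 * r + 3 ≤ R) (u : ℕ) :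
    ∀ (x : Fin N → ℕ), StrictMono x → (∀ j, 1 ≤ x j) → u ≤ N →
      ∑ P ∈ paths N r R u x, ∏ j, endWt (P j) = detSum N r R u x := by
  induction u with
  | zero =>
    intro x hx h1 hu
    rw [detSum_zero hx, paths]
    split_ifs with h
    · simp [endWt, endsNorth_singleton]
    · simp
  | succ u ih =>
    intro x hx h1 hu
    have hgood : ∀ d ∈ moves R u x, ∀ P ∈ paths N r R u (shift x d),
        Good N r R u (shift x d) P := fun d hd P hP =>
      (mem_paths hR u _ (moves_strictMono hd) (shift_pos h1 d) (by omega) P).1 hP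
    have hinj : Function.Injective (consAt u x) := by
      intro P Q h
      funext j
      have := congrFun h j
      unfold consAt at this
      split_ifs at this
      · simpa using this
      · exact this
    rw [detSum_succ hx, paths, Finset.sum_biUnion]
    · refine Finset.sum_congr rfl fun d hd => ?_
      rw [Finset.sum_image hinj.injOn,
        ← ih _ (moves_strictMono hd) (shift_pos h1 d) (by omega), Finset.mul_sum]
      refine Finset.sum_congr rfl fun P hP => ?_
      rw [← Finset.prod_mul_distrib]
      exact Finset.prod_congr rfl fun j _ => endWt_step h1 hd (hgood d hd P hP) j
    · intro d hd d' hd' hne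
      rw [Function.onFun, Finset.disjoint_left]
      intro P hP hP'
      obtain ⟨Q, hQ, rfl⟩ := Finset.mem_image.1 hP
      obtain ⟨Q', hQ', hQQ⟩ := Finset.mem_image.1 hP'
      have := hinj hQQ
      subst this
      apply hne
      funext j
      have e1 := (hgood d hd _ hQ).2.1 j
      have e2 := (hgood d' hd' _ hQ').2.1 j
      rw [e1] at e2
      simp [AstPaths.hd, shift] at e2
      exact Fin.ext e2.1

open Classical in
theorem prod_endWt {N : ℕ} (P : Fin N → List (ℤ × ℤ)) :
    ∏ j, endWt (P j) = Polynomial.X ^ Nat.card {j : Fin N // EndsNorth (P j)} := by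
  unfold endWt
  rw [Finset.prod_ite, Finset.prod_const, Finset.prod_const_one, mul_one,
    Nat.card_eq_fintype_card, Fintype.card_subtype]

end AstPaths

/-- For `0 ≤ l ≤ n-2 < r ≤ 2n-3` with `l + r < 2n-2` and `r - l > n-3`,
`Σ_{1 ≤ e_1 < … < e_{n-1} ≤ r+1} astDet n l r e` is the generating function in `t` of
`(n-1)`-tuples of non-intersecting north/east lattice paths starting at `S_j = (j, -2j)`
(`j = 1,…,n-1`), ending among `E_m = (m,-m)` (`1 ≤ m ≤ r+1`), whose path starting at
`S_{n-1}` stays weakly above the line `y = x + l - r - 2n + 1`, a tuple being weighted by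
`t^{#(paths ending with a north step)}`. -/
theorem detSum_eq_genFun_paths (n l r : ℕ) (hl : l + 2 ≤ n) (hr1 : n < r + 2)
    (hr2 : r + 3 ≤ 2 * n) (hlr : l + r + 2 < 2 * n) (hwide : l + n < r + 3) (w : ℕ) :
    (∑ e ∈ incTuples (n - 1) r, astDet n l r e).coeff w
      = Nat.card {P : Fin (n - 1) → List (ℤ × ℤ) //
          (∀ j, IsLatticePath (P j)) ∧
          (∀ j : Fin (n - 1), (P j).head? = some (((j : ℕ) : ℤ) + 1, -2 * (((j : ℕ) : ℤ) + 1))) ∧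
          (∀ j : Fin (n - 1), ∃ m : ℕ, 1 ≤ m ∧ m ≤ r + 1 ∧
            (P j).getLast? = some ((m : ℤ), -(m : ℤ))) ∧
          (∀ j k : Fin (n - 1), j ≠ k → ∀ q ∈ P j, q ∉ P k) ∧
          (∀ j : Fin (n - 1), (j : ℕ) = n - 2 → ∀ q ∈ P j,
            q.1 + (l : ℤ) - (r : ℤ) - 2 * (n : ℤ) + 1 ≤ q.2) ∧
          Nat.card {j : Fin (n - 1) // EndsNorth (P j)} = w} := by
  classical
  have hN : ∀ j : Fin (n - 1), 1 ≤ (j : ℕ) + 1 := fun j => by omega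
  have hmono : StrictMono (fun j : Fin (n - 1) => (j : ℕ) + 1) := fun a b h => by
    have : (a : ℕ) < b := h
    show (a : ℕ) + 1 < b + 1
    omega
  have hR : 2 * r + 3 ≤ r + 2 * n - l := by omega
  rw [AstPaths.astDet_sum hl hlr hwide,
    ← AstPaths.sum_paths hR (n - 1) _ hmono hN le_rfl, Polynomial.finsetSum_coeff]
  simp_rw [AstPaths.prod_endWt, Polynomial.coeff_X_pow]
  rw [Finset.sum_boole]
  congr 1
  rw [← Nat.card_eq_finsetCard]
  refine Nat.card_congr (Equiv.subtypeEquivRight fun P => ?_)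
  rw [Finset.mem_filter, AstPaths.mem_paths hR (n - 1) _ hmono hN le_rfl]
  unfold AstPaths.Good
  have hcast : ((r + 2 * n - l : ℕ) : ℤ) = (r : ℤ) + 2 * n - l := by omega
  have hhd : ∀ j : Fin (n - 1), AstPaths.hd (n - 1) ((j : ℕ) + 1)
      = (((j : ℕ) : ℤ) + 1, -2 * (((j : ℕ) : ℤ) + 1)) := by
    intro j
    have := j.2
    unfold AstPaths.hd
    split_ifs with h
    · ext
      · simp
      · simp; omega
    · simp
  have hline : (∀ j : Fin (n - 1), (j : ℕ) + 1 = n - 1 → ∀ q ∈ P j,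
        q.1 + 1 - ((r + 2 * n - l : ℕ) : ℤ) ≤ q.2) ↔
      (∀ j : Fin (n - 1), (j : ℕ) = n - 2 → ∀ q ∈ P j,
        q.1 + (l : ℤ) - (r : ℤ) - 2 * (n : ℤ) + 1 ≤ q.2) := by
    rw [hcast]
    refine forall_congr' fun j => ?_
    constructor
    · intro h hj q hq
      have := h (by omega) q hq
      omega
    · intro h hj q hq
      have := h (by omega) q hq
      omega
  simp_rw [hhd]
  rw [hline, eq_comm (a := w)]
  tauto
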